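/- In a commutative A-loop Q, the set K_1(Q) = {x^2 : x ∈ Q} of squares is a normal subloop of Q. -/

import Mathlib

/-- A commutative loop: commutative binary operation with two-sided identity
and a left division making all translations bijective. -/
class CommLoop (Q : Type*) extends Mul Q, One Q where
  mul_comm : ∀ x y : Q, x * y = y * x
  one_mul : ∀ x : Q, 1 * x = x
  mul_one : ∀ x : Q, x * 1 = x
  ldiv : Q → Q → Q
  mul_ldiv : ∀ x y : Q, x * ldiv x y = y
  ldiv_mul : ∀ x y : Q, ldiv x (x * y) = y

namespace CommLoop

variable {Q : Type*} [CommLoop Q]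

/-- The inverse `x⁻¹ = x \ 1`. -/
def inv (x : Q) : Q := ldiv x 1

/-- The inner mapping `L_{x,y} = L_x L_y L_{yx}⁻¹` (permutations acting on the right):
`z L_{x,y} = (yx) \ (y(xz))`. -/
def inn (x y z : Q) : Q := ldiv (y * x) (y * (x * z))

/-- Natural powers: `x^n = 1 L_x^n`. -/
def npow (x : Q) (n : ℕ) : Q := (fun y => x * y)^[n] 1

/-- Integer powers: `x^n = 1 L_x^n`. -/
def zpow (x : Q) : ℤ → Q
  | Int.ofNat n => npow x n
  | Int.negSucc n => (fun y => ldiv x y)^[n + 1] 1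

/-- A commutative A-loop: every inner mapping `L_{x,y}` is an automorphism. -/
class IsALoop (Q : Type*) [CommLoop Q] : Prop where
  inn_mul : ∀ x y u v : Q, inn x y (u * v) = inn x y u * inn x y v

/-- The left translation `L_x` as a permutation of `Q`. -/
def Le (x : Q) : Equiv.Perm Q :=
  ⟨fun y => x * y, fun y => ldiv x y, fun y => ldiv_mul x y, fun y => mul_ldiv x y⟩

/-- The permutation `P_x = L_x L_{x⁻¹}⁻¹`. -/
def Pe (x : Q) : Equiv.Perm Q := (Le x).trans (Le (inv x)).symm

end CommLoop

namespace CommLoop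

variable {Q : Type*} [CommLoop Q]

theorem mul_left_cancel_loop {x y z : Q} (h : x * y = x * z) : y = z := by
  rw [← ldiv_mul x y, h, ldiv_mul]

/-- The defining property of the inner mapping `L_{x,y}`. -/
theorem mul_inn (x y z : Q) : (y * x) * inn x y z = y * (x * z) :=
  mul_ldiv _ _

theorem inn_injective (x y : Q) : Function.Injective (inn x y) := fun u v h => by
  have h' := congrArg (fun t => (y * x) * t) h
  simp only [mul_inn] at h'
  exact mul_left_cancel_loop (mul_left_cancel_loop h')

theorem inn_surjective (x y : Q) : Function.Surjective (inn x y) := fun z =>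
  ⟨ldiv x (ldiv y ((y * x) * z)), by simp only [inn, mul_ldiv, ldiv_mul]⟩

/-- The inner mapping `L_{x,y}` fixes `y`. -/
theorem inn_self_right (x y : Q) : inn x y y = y := by
  rw [inn, mul_comm x y, mul_comm y (y * x), ldiv_mul]

theorem inn_one (x y : Q) : inn x y 1 = 1 := by
  apply mul_left_cancel_loop (x := y * x)
  rw [mul_inn, mul_one, mul_one]

variable [IsALoop Q]

/-- An inner mapping reflects squares. -/
theorem eq_sq_of_inn_eq_sq {x y c s : Q} (h : inn x y c = s * s) : ∃ t, c = t * t := by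
  obtain ⟨t, rfl⟩ := inn_surjective x y s
  exact ⟨t, inn_injective x y (by rw [h, IsALoop.inn_mul])⟩

/-- `L_{x,y}` maps `(yx)²` to `y(yx²)`. -/
theorem inn_mul_self_mul (x y : Q) :
    inn x y ((y * x) * (y * x)) = y * (y * (x * x)) := by
  obtain ⟨w, hw⟩ := inn_surjective x y (y * x)
  calc inn x y ((y * x) * (y * x)) = inn x y (y * (x * w)) := by rw [← mul_inn x y w, hw]
    _ = y * (inn x y x * (y * x)) := by
      rw [IsALoop.inn_mul, IsALoop.inn_mul, inn_self_right, hw]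
    _ = y * (y * (x * x)) := by rw [mul_comm (inn x y x), mul_inn]

/-- The square of `yx` and the product `y²x²` are related by inner mappings. -/
theorem inn_sq_mul_sq (x y : Q) :
    inn y y ((y * y) * (x * x)) = inn x y ((y * x) * (y * x)) := by
  rw [inn_mul_self_mul, IsALoop.inn_mul, IsALoop.inn_mul, inn_self_right, mul_inn]

theorem exists_sq_mul_sq (x y : Q) : ∃ z, (y * y) * (x * x) = z * z :=
  eq_sq_of_inn_eq_sq (by rw [inn_sq_mul_sq, IsALoop.inn_mul])

theorem sq_mul_sq_ldiv_one (x : Q) : (x * x) * (ldiv x 1 * ldiv x 1) = 1 := by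
  apply inn_injective x x
  rw [inn_sq_mul_sq, mul_ldiv, one_mul, inn_one, inn_one]

theorem exists_ldiv_sq_sq (x y : Q) : ∃ z, ldiv (x * x) (y * y) = z * z := by
  obtain ⟨s, hs⟩ := exists_sq_mul_sq y (ldiv x 1)
  refine eq_sq_of_inn_eq_sq (x := x * x) (y := ldiv x 1 * ldiv x 1) (s := s) ?_
  have h := mul_inn (x * x) (ldiv x 1 * ldiv x 1) (ldiv (x * x) (y * y))
  rwa [mul_comm _ (x * x), sq_mul_sq_ldiv_one, one_mul, mul_ldiv, hs] at h

end CommLoop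

open CommLoop in
/-- The set of squares `K₁(Q) = {x² : x ∈ Q}` is a normal subloop: it contains `1`,
is closed under multiplication and left division, and is invariant under all inner
mappings. -/
theorem stmt17 {Q : Type*} [CommLoop Q] [IsALoop Q] :
    (1 : Q) ∈ {z : Q | ∃ x, z = x * x} ∧
    (∀ a ∈ {z : Q | ∃ x, z = x * x}, ∀ b ∈ {z : Q | ∃ x, z = x * x},
      a * b ∈ {z : Q | ∃ x, z = x * x}) ∧
    (∀ a ∈ {z : Q | ∃ x, z = x * x}, ∀ b ∈ {z : Q | ∃ x, z = x * x},
      ldiv a b ∈ {z : Q | ∃ x, z = x * x}) ∧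
    (∀ x y : Q, ∀ z ∈ {z : Q | ∃ x, z = x * x}, inn x y z ∈ {z : Q | ∃ x, z = x * x}) := by
  refine ⟨⟨1, (CommLoop.one_mul 1).symm⟩, ?_, ?_, ?_⟩
  · rintro _ ⟨x, rfl⟩ _ ⟨y, rfl⟩
    exact exists_sq_mul_sq y x
  · rintro _ ⟨x, rfl⟩ _ ⟨y, rfl⟩
    exact exists_ldiv_sq_sq x y
  · rintro x y _ ⟨z, rfl⟩
    exact ⟨inn x y z, IsALoop.inn_mul x y z z⟩
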